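/- For every natural number n there exists a finite group G of exponent 4 (hence a finite 2-group) such that: G is generated by its set of involutions (i.e., the subgroup generated by {g \in G : g^2 = 1} is all of G); every involution u of G is a left 2-Engel element of G (i.e., [x,u,u] = 1 for all x in G); and the derived length of G is greater than n (equivalently, the n-th term of the derived series of G is nontrivial). In particular, there is no upper bound on the derived lengths of finite 2-groups generated by involutions in which every involution is left 2-Engel; this answers Problem 18.57 of the Kourovka Notebook negatively. -/

import Mathlib

/-- Left-normed commutator `[a,b] = a⁻¹ * b⁻¹ * a * b`. -/
def lcomm {G : Type*} [Group G] (a b : G) : G := a⁻¹ * b⁻¹ * a * b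

/-- Half of the six-term relation between the entries of a symmetric array in characteristic two. -/
def hexagon {R : Type*} [CommRing R] (w : Fin 6 → Fin 6 → R) : R :=
  w 0 1 * w 2 3 * w 4 5 + w 1 2 * w 3 4 * w 5 0 + w 0 3 * w 1 4 * w 2 5

/-- The vertices of a disjoint union of `m + 1` edges. -/
abbrev Letter (m : ℕ) : Type := Fin (m + 1) × Bool

namespace Letter

open MvPolynomial

variable {m : ℕ}

/-- The value at a letter of the assignment determined by `L`. -/
def value (L : Fin (m + 1) → ZMod 2) (a : Letter m) : ZMod 2 :=
  if a.2 then L (a.1 + 1) + 1 else L a.1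

/-- The linear part of the affine map `L ↦ value L a`. -/
def linearValue (a : Letter m) : (Fin (m + 1) → ZMod 2) →ₗ[ZMod 2] ZMod 2 :=
  LinearMap.proj (if a.2 then a.1 + 1 else a.1)

theorem value_add (L f : Fin (m + 1) → ZMod 2) (a : Letter m) :
    value (L + f) a = value L a + linearValue a f := by
  unfold value linearValue
  split_ifs
  · simp; ring
  · simp

/-- The sign of a residue modulo two. -/
def charge (x : ZMod 2) : ℤ := if x = 0 then 1 else -1

theorem charge_add_of_ne : ∀ x y : ZMod 2, x ≠ y → charge x + charge y = 0 := by decide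

theorem charge_add_one : ∀ x : ZMod 2, charge (x + 1) = - charge x := by decide

theorem sum_charge_value (L : Fin (m + 1) → ZMod 2) : ∑ a : Letter m, charge (value L a) = 0 := by
  rw [Fintype.sum_prod_type]
  simp only [Fintype.sum_bool, value, if_true, Bool.false_eq_true, if_false, charge_add_one]
  rw [Finset.sum_add_distrib, Finset.sum_neg_distrib,
    ← Equiv.sum_comp (Equiv.addRight (1 : Fin (m + 1))) (fun j => charge (L j))]
  simp

theorem hexagon_eq_one : ∀ s : Fin 6 → ZMod 2, ∑ i, charge (s i) = 0 →
    hexagon (fun i j => s i + s j) = 1 := by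
  unfold hexagon
  decide

/-- The substitution of `(value L a + value L b) * (X a * X b)` for the edge from `a` to `b`. -/
noncomputable def evalAt (L : Fin (m + 1) → ZMod 2) :
    MvPolynomial (Letter m × Letter m) (ZMod 2) →ₐ[ZMod 2] MvPolynomial (Letter m) (ZMod 2) :=
  aeval fun p => C (value L p.1 + value L p.2) * (X p.1 * X p.2)

/-- The functional whose radical is the ideal of relations. -/
noncomputable def functional :
    MvPolynomial (Letter m × Letter m) (ZMod 2) →ₗ[ZMod 2] ZMod 2 :=
  ∑ L : {L : Fin (m + 1) → ZMod 2 // L 0 = 0},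
    lcoeff (ZMod 2) (Finsupp.equivFunOnFinite.symm fun _ => 1) ∘ₗ (evalAt L.1).toLinearMap

theorem functional_apply (f : MvPolynomial (Letter m × Letter m) (ZMod 2)) :
    functional f = ∑ L : {L : Fin (m + 1) → ZMod 2 // L 0 = 0},
      coeff (Finsupp.equivFunOnFinite.symm fun _ => 1) (evalAt L.1 f) := by
  simp [functional]

/-- The number of times each letter is used by the edges in `e`. -/
noncomputable def multidegree (e : Letter m × Letter m →₀ ℕ) : Letter m →₀ ℕ :=
  e.sum fun p n => n • (Finsupp.single p.1 1 + Finsupp.single p.2 1)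

theorem evalAt_X (L : Fin (m + 1) → ZMod 2) (p : Letter m × Letter m) :
    evalAt L (X p) = monomial (Finsupp.single p.1 1 + Finsupp.single p.2 1)
      (value L p.1 + value L p.2) := by
  rw [evalAt, aeval_X, X, X, monomial_mul, C_mul_monomial]
  simp

theorem evalAt_monomial (L : Fin (m + 1) → ZMod 2) (e : Letter m × Letter m →₀ ℕ) :
    evalAt L (monomial e 1) =
      monomial (multidegree e) (e.prod fun p n => (value L p.1 + value L p.2) ^ n) := by
  rw [multidegree, monomial_finsupp_sum_index, evalAt, aeval_monomial, map_one, one_mul,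
    Finsupp.prod, Finsupp.prod, Finsupp.prod, map_prod, ← Finset.prod_mul_distrib]
  refine Finset.prod_congr rfl fun p _ => ?_
  rw [mul_pow, map_pow, X, X, monomial_mul, monomial_pow]
  simp

theorem evalAt_hexagon_mul_monomial (L : Fin (m + 1) → ZMod 2) (a : Fin 6 → Letter m)
    (e : Letter m × Letter m →₀ ℕ) :
    evalAt L (hexagon (fun i j => X (a i, a j)) * monomial e 1) =
      monomial (∑ i, Finsupp.single (a i) 1 + multidegree e)
        (hexagon (fun i j => value L (a i) + value L (a j)) *
          e.prod fun p n => (value L p.1 + value L p.2) ^ n) := by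
  rw [map_mul, evalAt_monomial, hexagon, hexagon, ← monomial_mul]
  congr 1
  rw [map_add (evalAt L), map_add (evalAt L), map_add (monomial _), map_add (monomial _)]
  simp only [map_mul, evalAt_X, monomial_mul, Fin.sum_univ_six]
  congr 3 <;> ac_rfl

theorem sum_multidegree_mul (e : Letter m × Letter m →₀ ℕ) (h : Letter m → ℤ) :
    ∑ x, (multidegree e x : ℤ) * h x = e.sum fun p n => (n : ℤ) * (h p.1 + h p.2) := by
  rw [multidegree, Finsupp.sum, Finsupp.sum]
  simp only [Finsupp.finsetSum_apply, Nat.cast_sum, Finset.sum_mul]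
  rw [Finset.sum_comm]
  refine Finset.sum_congr rfl fun p _ => ?_
  simp [Finsupp.single_apply, add_mul, mul_add, Finset.sum_add_distrib]

theorem sum_sum_single_mul (a : Fin 6 → Letter m) (h : Letter m → ℤ) :
    ∑ x, ((∑ i, Finsupp.single (a i) 1 : Letter m →₀ ℕ) x : ℤ) * h x = ∑ i, h (a i) := by
  simp only [Finsupp.finsetSum_apply, Nat.cast_sum, Finset.sum_mul]
  rw [Finset.sum_comm]
  simp [Finsupp.single_apply]

theorem sum_add_sum_of_eq_one {a : Fin 6 → Letter m} {e : Letter m × Letter m →₀ ℕ}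
    (he : ∑ i, Finsupp.single (a i) 1 + multidegree e =
      Finsupp.equivFunOnFinite.symm fun _ => 1) (h : Letter m → ℤ) :
    ∑ i, h (a i) + e.sum (fun p n => (n : ℤ) * (h p.1 + h p.2)) = ∑ x, h x := by
  rw [← sum_multidegree_mul, ← sum_sum_single_mul, ← Finset.sum_add_distrib]
  refine Finset.sum_congr rfl fun x _ => ?_
  have := DFunLike.congr_fun he x
  rw [Finsupp.add_apply, Finsupp.equivFunOnFinite_symm_apply_apply] at this
  rw [← add_mul, ← Nat.cast_add, this]
  simp

theorem hexagon_mul_prod {a : Fin 6 → Letter m} {e : Letter m × Letter m →₀ ℕ}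
    (he : ∑ i, Finsupp.single (a i) 1 + multidegree e =
      Finsupp.equivFunOnFinite.symm fun _ => 1) (L : Fin (m + 1) → ZMod 2) :
    hexagon (fun i j => value L (a i) + value L (a j)) *
        (e.prod fun p n => (value L p.1 + value L p.2) ^ n) =
      if ∀ p ∈ e.support, value L p.1 ≠ value L p.2 then 1 else 0 := by
  split_ifs with hne
  · have hs : ∑ i, charge (value L (a i)) = 0 := by
      have := sum_add_sum_of_eq_one he fun x => charge (value L x)
      rw [sum_charge_value, Finsupp.sum, Finset.sum_eq_zero (s := e.support), add_zero] at this
      · exact this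
      · intro p hp
        rw [charge_add_of_ne _ _ (hne p hp), mul_zero]
    rw [hexagon_eq_one _ hs, one_mul]
    refine Finset.prod_eq_one fun p hp => ?_
    have : ∀ x y : ZMod 2, x ≠ y → x + y = 1 := by decide
    simp only [this _ _ (hne p hp), one_pow]
  · push Not at hne
    obtain ⟨p, hp, hv⟩ := hne
    rw [Finsupp.prod, Finset.prod_eq_zero hp, mul_zero]
    simp only [hv, CharTwo.add_self_eq_zero, zero_pow (Finsupp.mem_support_iff.1 hp)]

theorem card_support_add_three_le {a : Fin 6 → Letter m} {e : Letter m × Letter m →₀ ℕ}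
    (he : ∑ i, Finsupp.single (a i) 1 + multidegree e =
      Finsupp.equivFunOnFinite.symm fun _ => 1) : e.support.card + 3 ≤ m + 1 := by
  have h := sum_add_sum_of_eq_one he fun _ => 1
  have hc : (e.support.card : ℤ) ≤ e.sum fun _ n => (n : ℤ) := by
    rw [Finset.cast_card]
    refine Finset.sum_le_sum fun p hp => ?_
    have := Nat.pos_of_ne_zero (Finsupp.mem_support_iff.1 hp)
    simpa [Nat.one_le_iff_ne_zero] using this.ne'
  rw [Finsupp.sum, ← Finset.sum_mul] at h
  rw [Finsupp.sum] at hc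
  simp at h hc
  lia

theorem exists_ne_zero_linearValue_eq (s : Finset (Letter m × Letter m)) (hs : s.card < m) :
    ∃ f : Fin (m + 1) → ZMod 2, f ≠ 0 ∧ f 0 = 0 ∧
      ∀ p ∈ s, linearValue p.1 f = linearValue p.2 f := by
  let T : (Fin (m + 1) → ZMod 2) →ₗ[ZMod 2] (Option s → ZMod 2) :=
    LinearMap.pi fun o => o.elim (LinearMap.proj 0)
      fun p => linearValue p.1.1 - linearValue p.1.2
  have hT : LinearMap.ker T ≠ ⊥ := LinearMap.ker_ne_bot_of_finrank_lt (by simp; lia)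
  obtain ⟨f, hf, hf0⟩ := Submodule.exists_mem_ne_zero_of_ne_bot hT
  refine ⟨f, hf0, congr_fun hf none, fun p hp => ?_⟩
  exact sub_eq_zero.1 (congr_fun hf (some ⟨p, hp⟩))

theorem functional_hexagon_mul (a : Fin 6 → Letter m)
    (g : MvPolynomial (Letter m × Letter m) (ZMod 2)) :
    functional (hexagon (fun i j => X (a i, a j)) * g) = 0 := by
  induction g using induction_on' with
  | add p q hp hq => rw [mul_add, map_add, hp, hq, add_zero]
  | monomial e r =>
    rw [← mul_one r, ← smul_eq_mul r, ← smul_monomial, mul_smul_comm, map_smul, functional_apply]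
    simp only [evalAt_hexagon_mul_monomial, coeff_monomial]
    split_ifs with he
    · simp only [hexagon_mul_prod he]
      have hc := card_support_add_three_le he
      obtain ⟨f, hf, hf0, hv⟩ := exists_ne_zero_linearValue_eq e.support (by lia)
      rw [Finset.sum_involution (fun L _ => ⟨L.1 + f, by simp [L.2, hf0]⟩), smul_zero]
      · intro L _
        have : (∀ p ∈ e.support, value (L.1 + f) p.1 ≠ value (L.1 + f) p.2) ↔
            ∀ p ∈ e.support, value L.1 p.1 ≠ value L.1 p.2 := by
          refine forall₂_congr fun p hp => ?_
          rw [value_add, value_add, hv p hp, Ne, Ne, add_left_inj]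
        simp only [this]
        exact CharTwo.add_self_eq_zero _
      · intro L _ _ h
        exact hf (by simpa using congrArg Subtype.val h)
      · intro L _
        exact Finset.mem_univ _
      · intro L _
        ext1
        simp [add_assoc, CharTwo.add_self_eq_zero]
    · simp

theorem coeff_X_mul_X_mul (a : Letter m) (f : MvPolynomial (Letter m) (ZMod 2)) :
    coeff (Finsupp.equivFunOnFinite.symm fun _ => 1) (X a * (X a * f)) = 0 := by
  rw [coeff_X_mul', coeff_X_mul']
  simp

theorem functional_nil (a b c : Letter m) (g : MvPolynomial (Letter m × Letter m) (ZMod 2)) :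
    functional (X (a, b) * X (a, c) * g) = 0 := by
  rw [functional_apply]
  refine Finset.sum_eq_zero fun L _ => ?_
  rw [map_mul, map_mul, evalAt, aeval_X, aeval_X]
  refine (congrArg _ ?_).trans (coeff_X_mul_X_mul a
    (C (value L.1 a + value L.1 b) * C (value L.1 a + value L.1 c) * (X b * X c) *
      aeval (fun p => C (value L.1 p.1 + value L.1 p.2) * (X p.1 * X p.2)) g))
  ring

theorem functional_eq_zero_of_evalAt {f : MvPolynomial (Letter m × Letter m) (ZMod 2)}
    (hf : ∀ L, evalAt L f = 0) (g : MvPolynomial (Letter m × Letter m) (ZMod 2)) :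
    functional (f * g) = 0 := by
  simp [functional_apply, hf]

theorem evalAt_symm (L : Fin (m + 1) → ZMod 2) (a b : Letter m) :
    evalAt L (X (a, b) - X (b, a)) = 0 := by
  rw [evalAt, map_sub, aeval_X, aeval_X]
  dsimp only
  rw [add_comm]
  ring

theorem evalAt_self (L : Fin (m + 1) → ZMod 2) (a : Letter m) : evalAt L (X (a, a)) = 0 := by
  rw [evalAt, aeval_X]
  dsimp only
  rw [CharTwo.add_self_eq_zero, map_zero, zero_mul]

theorem evalAt_pluecker (L : Fin (m + 1) → ZMod 2) (a b c d : Letter m) :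
    evalAt L (X (a, b) * X (c, d) + X (a, c) * X (b, d) + X (a, d) * X (b, c)) = 0 := by
  simp only [evalAt, map_add, map_mul, aeval_X]
  have h2 : (2 : MvPolynomial (Letter m) (ZMod 2)) = 0 := CharTwo.two_eq_zero
  linear_combination ((C (value L a) + C (value L b)) * (C (value L c) + C (value L d))
    + C (value L a) * C (value L b) + C (value L c) * C (value L d)) *
    (X a * X b * X c * X d) * h2

theorem functional_prod :
    functional (∏ j : Fin (m + 1), X ((j, false), (j, true))) = 1 := by
  have (L : Fin (m + 1) → ZMod 2) :
      coeff (Finsupp.equivFunOnFinite.symm fun _ => 1)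
        (evalAt L (∏ j : Fin (m + 1), X ((j, false), (j, true)))) =
      if ∀ j, L (j + 1) = L j then 1 else 0 := by
    have hv : ∏ j, (value L (j, false) + value L (j, true)) =
        if ∀ j, L (j + 1) = L j then 1 else 0 := by
      have h01 : ∀ x y : ZMod 2, x + (y + 1) = if y = x then 1 else 0 := by decide
      simp only [value, Bool.false_eq_true, if_true, if_false, h01, Finset.prod_ite_zero]
      simp
    rw [map_prod, ← hv]
    simp only [evalAt_X]
    rw [← monomial_sum_prod, coeff_monomial, if_pos]
    ext ⟨i, t⟩
    cases t <;> simp [Finsupp.single_apply, Finset.sum_add_distrib]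
  rw [functional_apply, Finset.sum_eq_single ⟨0, rfl⟩]
  · rw [this]
    simp
  · intro L _ hL
    rw [this, if_neg]
    intro h
    refine hL (Subtype.ext (funext fun j => ?_))
    induction j using Fin.induction with
    | zero => exact L.2
    | succ i ih => rw [← Fin.coeSucc_eq_succ, h, ih]; rfl
  · simp

variable (m) in
/-- The ideal of polynomials all of whose multiples are killed by the functional. -/
noncomputable def relations : Ideal (MvPolynomial (Letter m × Letter m) (ZMod 2)) where
  carrier := {f | ∀ g, functional (f * g) = 0}
  zero_mem' g := by simp
  add_mem' hf hf' g := by rw [add_mul, map_add, hf, hf', add_zero]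
  smul_mem' c f hf g := by rw [smul_eq_mul, mul_comm c, mul_assoc, hf]

theorem mem_relations {f : MvPolynomial (Letter m × Letter m) (ZMod 2)} :
    f ∈ relations m ↔ ∀ g, functional (f * g) = 0 := Iff.rfl

variable (m) in
/-- The ring generated by the edges. -/
abbrev Coeff : Type := MvPolynomial (Letter m × Letter m) (ZMod 2) ⧸ relations m

/-- The edge between two letters. -/
noncomputable def edge (a b : Letter m) : Coeff m := Ideal.Quotient.mk _ (X (a, b))

theorem edge_comm (a b : Letter m) : edge a b = edge b a := by
  rw [edge, edge, Ideal.Quotient.eq, mem_relations]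
  exact functional_eq_zero_of_evalAt fun L => evalAt_symm L a b

theorem edge_self (a : Letter m) : edge a a = 0 := by
  rw [edge, Ideal.Quotient.eq_zero_iff_mem, mem_relations]
  exact functional_eq_zero_of_evalAt fun L => evalAt_self L a

theorem edge_mul_edge (a b c : Letter m) : edge a b * edge a c = 0 := by
  rw [edge, edge, ← map_mul, Ideal.Quotient.eq_zero_iff_mem, mem_relations]
  exact functional_nil a b c

theorem edge_pluecker (a b c d : Letter m) :
    edge a b * edge c d + edge a c * edge b d + edge a d * edge b c = 0 := by
  simp only [edge, ← map_mul, ← map_add, Ideal.Quotient.eq_zero_iff_mem, mem_relations]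
  exact functional_eq_zero_of_evalAt fun L => evalAt_pluecker L a b c d

theorem hexagon_edge (a : Fin 6 → Letter m) : hexagon (fun i j => edge (a i) (a j)) = 0 := by
  simp only [hexagon, edge, ← map_mul, ← map_add, Ideal.Quotient.eq_zero_iff_mem, mem_relations]
  exact functional_hexagon_mul a

theorem prod_edge_ne_zero : ∏ j : Fin (m + 1), edge (j, false) (j, true) ≠ 0 := by
  simp only [edge, ← map_prod, Ne, Ideal.Quotient.eq_zero_iff_mem, mem_relations]
  intro h
  have := h 1
  rw [mul_one, functional_prod] at this
  exact one_ne_zero this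

instance : CharP (Coeff m) 2 := by
  have : Nontrivial (Coeff m) := ⟨_, _, prod_edge_ne_zero⟩
  exact charP_of_injective_algebraMap (algebraMap (ZMod 2) (Coeff m)).injective 2

instance : Finite (Coeff m) := by
  have : Algebra.IsIntegral (ZMod 2) (Coeff m) := by
    refine ⟨fun x => ?_⟩
    obtain ⟨f, rfl⟩ := Ideal.Quotient.mk_surjective x
    induction f using MvPolynomial.induction_on with
    | C r => exact isIntegral_algebraMap
    | add f g hf hg => rw [map_add]; exact hf.add hg
    | mul_X f p hf =>
      rw [map_mul]
      refine hf.mul (IsIntegral.of_pow two_pos ?_)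
      rw [pow_two]
      exact edge_mul_edge p.1 p.2 p.2 ▸ isIntegral_zero
  have := Algebra.IsIntegral.finite (R := ZMod 2) (A := Coeff m)
  exact Module.finite_of_finite (ZMod 2)

end Letter

/-- A nondegenerate alternating form over a ring of characteristic two satisfying the
three-term relation and the six-term relation. -/
structure IsHexagonal {B M : Type*} [CommRing B] [AddCommGroup M] [Module B M]
    (b : M →ₗ[B] M →ₗ[B] B) : Prop where
  alt : ∀ x, b x x = 0
  symm : ∀ x y, b x y = b y x
  eq_zero : ∀ x, (∀ y, b x y = 0) → x = 0
  cyc : ∀ x y z, b x y • z + b y z • x + b z x • y = 0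
  hex : ∀ x y z w u, (b z w * b y u) • x + (b y w * b z x) • u + (b x y * b u z) • w = 0

/-- The relations between the edges of a graph that yield a hexagonal form. -/
structure IsEdgeSystem {ι B : Type*} [CommRing B] (β : ι → ι → B) : Prop where
  comm : ∀ i j, β i j = β j i
  self : ∀ i, β i i = 0
  mul : ∀ i j k, β i j * β i k = 0
  pluecker : ∀ i j k l, β i j * β k l + β i k * β j l + β i l * β j k = 0
  hexagon : ∀ a : Fin 6 → ι, hexagon (fun i j => β (a i) (a j)) = 0

namespace IsEdgeSystem

variable {ι B : Type*} [CommRing B] [Fintype ι] [DecidableEq ι] {β : ι → ι → B}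

variable (β) in
/-- The bilinear form on the free module with Gram matrix `β`. -/
noncomputable def gram : (ι → B) →ₗ[B] (ι → B) →ₗ[B] B :=
  Matrix.toLinearMap₂' B (Matrix.of β)

variable (β) in
/-- The quotient of the free module by the radical of the form. -/
abbrev Space : Type _ := (ι → B) ⧸ LinearMap.ker (gram β)

variable (β) in
/-- The vector attached to an index. -/
noncomputable def vec (i : ι) : Space β := Submodule.Quotient.mk (Pi.single i 1)

theorem vec_induction {P : Space β → Prop} (hvec : ∀ i, P (vec β i))
    (hadd : ∀ x y, P x → P y → P (x + y)) (hsmul : ∀ (r : B) x, P x → P (r • x))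
    (hzero : P 0) (x : Space β) : P x := by
  obtain ⟨c, rfl⟩ := Submodule.mkQ_surjective _ x
  rw [pi_eq_sum_univ' c, map_sum]
  refine Finset.sum_induction _ P hadd hzero fun i _ => ?_
  rw [map_smul]
  exact hsmul _ _ (hvec i)

variable (h : IsEdgeSystem β)
include h

theorem gram_comm (x y : ι → B) : gram β x y = gram β y x := by
  rw [gram, Matrix.toLinearMap₂'_apply, Matrix.toLinearMap₂'_apply, Finset.sum_comm]
  refine Finset.sum_congr rfl fun i _ => Finset.sum_congr rfl fun j _ => ?_
  rw [Matrix.of_apply, Matrix.of_apply, h.comm, smul_eq_mul, smul_eq_mul, smul_eq_mul, smul_eq_mul,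
    mul_left_comm]

/-- The form induced on the quotient by the radical. -/
noncomputable def form : Space β →ₗ[B] Space β →ₗ[B] B :=
  (LinearMap.ker (gram β)).liftQ ((LinearMap.ker (gram β)).liftQ (gram β) le_rfl).flip
    (by
      intro x hx
      rw [LinearMap.mem_ker] at hx ⊢
      refine LinearMap.ext fun y => ?_
      obtain ⟨d, rfl⟩ := Submodule.Quotient.mk_surjective _ y
      rw [LinearMap.flip_apply, Submodule.liftQ_apply, h.gram_comm, hx]
      rfl)

theorem form_mk (x y : ι → B) :
    h.form (Submodule.Quotient.mk x) (Submodule.Quotient.mk y) = gram β x y :=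
  h.gram_comm y x

theorem form_vec (i j : ι) : h.form (vec β i) (vec β j) = β i j := by
  rw [vec, vec, form_mk, gram]
  simp [Matrix.toLinearMap₂'_apply, Pi.single_apply]

theorem form_comm (x y : Space β) : h.form x y = h.form y x := by
  obtain ⟨c, rfl⟩ := Submodule.Quotient.mk_surjective _ x
  obtain ⟨d, rfl⟩ := Submodule.Quotient.mk_surjective _ y
  rw [form_mk, form_mk, h.gram_comm]

theorem eq_zero_of_form (x : Space β) (hx : ∀ y, h.form x y = 0) : x = 0 := by
  obtain ⟨c, rfl⟩ := Submodule.Quotient.mk_surjective _ x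
  rw [Submodule.Quotient.mk_eq_zero, LinearMap.mem_ker]
  refine LinearMap.ext fun d => ?_
  rw [← h.form_mk, hx, LinearMap.zero_apply]

theorem form_vec_smul_vec (i : ι) (x : Space β) : h.form (vec β i) x • vec β i = 0 := by
  refine h.eq_zero_of_form _ fun y => ?_
  rw [map_smul, LinearMap.smul_apply, smul_eq_mul]
  induction x using vec_induction with
  | hzero => simp
  | hadd x y hx hy => rw [map_add, add_mul, hx, hy, add_zero]
  | hsmul r x hx => rw [map_smul, smul_eq_mul, mul_assoc, hx, mul_zero]
  | hvec j =>
    induction y using vec_induction with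
    | hzero => simp
    | hadd x y hx hy => rw [map_add, mul_add, hx, hy, add_zero]
    | hsmul r x hx => rw [map_smul, smul_eq_mul, mul_left_comm, hx, mul_zero]
    | hvec l => rw [form_vec, form_vec, h.mul]

theorem form_pluecker (x y z w : Space β) :
    h.form x y * h.form z w + h.form y z * h.form x w + h.form z x * h.form y w = 0 := by
  induction x using vec_induction
  case hvec i =>
    induction y using vec_induction
    case hvec j =>
      induction z using vec_induction
      case hvec k =>
        induction w using vec_induction
        case hvec l =>
          simp only [form_vec]
          linear_combination h.pluecker i j k l + β j l * h.comm k i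
        all_goals grind [map_smul, smul_eq_mul]
      all_goals grind [map_smul, smul_eq_mul, LinearMap.add_apply, LinearMap.smul_apply,
      LinearMap.zero_apply]
    all_goals grind [map_smul, smul_eq_mul, LinearMap.add_apply, LinearMap.smul_apply,
      LinearMap.zero_apply]
  all_goals grind [map_smul, smul_eq_mul, LinearMap.add_apply, LinearMap.smul_apply,
      LinearMap.zero_apply]

theorem form_hexagon (x y z w u t : Space β) :
    h.form z w * h.form y u * h.form x t + h.form y w * h.form z x * h.form u t +
      h.form x y * h.form u z * h.form w t = 0 := by
  induction z using vec_induction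
  case hvec i0 =>
    induction w using vec_induction
    case hvec i1 =>
      induction y using vec_induction
      case hvec i2 =>
        induction u using vec_induction
        case hvec i3 =>
          induction t using vec_induction
          case hvec i4 =>
            induction x using vec_induction
            case hvec i5 =>
              simp only [form_vec]
              have := h.hexagon ![i0, i1, i2, i3, i4, i5]
              simp only [_root_.hexagon, Matrix.cons_val] at this
              rw [h.comm i2 i1, h.comm i0 i5, h.comm i5 i2, h.comm i3 i0, h.comm i5 i4] at *
              linear_combination this
            all_goals grind [map_smul, smul_eq_mul, LinearMap.add_apply, LinearMap.smul_apply,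
              LinearMap.zero_apply]
          all_goals grind [map_smul, smul_eq_mul, LinearMap.add_apply, LinearMap.smul_apply,
            LinearMap.zero_apply]
        all_goals grind [map_smul, smul_eq_mul, LinearMap.add_apply, LinearMap.smul_apply,
          LinearMap.zero_apply]
      all_goals grind [map_smul, smul_eq_mul, LinearMap.add_apply, LinearMap.smul_apply,
        LinearMap.zero_apply]
    all_goals grind [map_smul, smul_eq_mul, LinearMap.add_apply, LinearMap.smul_apply,
      LinearMap.zero_apply]
  all_goals grind [map_smul, smul_eq_mul, LinearMap.add_apply, LinearMap.smul_apply,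
    LinearMap.zero_apply]

variable [CharP B 2]

theorem form_self (x : Space β) : h.form x x = 0 := by
  induction x using vec_induction with
  | hzero => simp
  | hvec i => rw [form_vec, h.self]
  | hadd x y hx hy =>
    rw [map_add, map_add, LinearMap.add_apply, LinearMap.add_apply, hx, hy, h.form_comm y x,
      zero_add, add_zero, CharTwo.add_self_eq_zero]
  | hsmul r x hx => simp [hx]

theorem isHexagonal_form : IsHexagonal h.form where
  alt := h.form_self
  symm := h.form_comm
  eq_zero := h.eq_zero_of_form
  cyc x y z := by
    refine h.eq_zero_of_form _ fun t => ?_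
    simpa using h.form_pluecker x y z t
  hex x y z w u := by
    refine h.eq_zero_of_form _ fun t => ?_
    simpa using h.form_hexagon x y z w u t

end IsEdgeSystem

section NormalForm

variable {B M : Type*} [CommRing B] [AddCommGroup M] [Module B M]

/-- The endomorphism of `B × M` attached to a vector of `M`. -/
def transvection (b : M →ₗ[B] M →ₗ[B] B) (v : M) : Module.End B (B × M) :=
  LinearMap.prod (LinearMap.fst B B M + b v ∘ₗ LinearMap.snd B B M)
    (LinearMap.snd B B M + (LinearMap.fst B B M).smulRight v)

@[simp]
theorem transvection_apply (b : M →ₗ[B] M →ₗ[B] B) (v : M) (c : B × M) :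
    transvection b v c = (c.1 + b v c.2, c.2 + c.1 • v) := rfl

theorem val_inv_apply (x : (Module.End B (B × M))ˣ) (c : B × M) :
    x.val (x.inv c) = c :=
  LinearMap.congr_fun x.val_inv c

theorem inv_val_apply (x : (Module.End B (B × M))ˣ) (c : B × M) :
    x.inv (x.val c) = c :=
  LinearMap.congr_fun x.inv_val c

variable {b : M →ₗ[B] M →ₗ[B] B}

variable (b) in
/-- The shape of the elements of the group generated by transvections. -/
structure NormalForm (x : (Module.End B (B × M))ˣ) where
  α : B
  θ : B
  ω : M
  ω' : M
  p : M →ₗ[B] M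
  val_apply : ∀ a w, x.val (a, w) = ((1 + α) * a + b ω' w, a • ω + p w)
  inv_apply : ∀ a w, x.inv (a, w) = ((1 + α) * a + b ω w, a • ω' + (p w + θ • w))
  adjoint : ∀ w u, b (p w) u = b w (p u) + θ * b w u
  hex : ∀ z w u, b z w • p u + b z (p w) • u + (θ * b u z) • w = 0
  form_ω_smul_ω : ∀ w, b ω w • ω = α • w
  form_ω'_smul_ω' : ∀ w, b ω' w • ω' = α • w
  form_ω'_smul_ω : ∀ w, b ω' w • ω = θ • w
  θ_smul_ω : θ • ω = 0
  θ_smul_ω' : θ • ω' = 0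
  commute : ∀ z : M →ₗ[B] M, (∀ r s w, z (b s w • r) = b s (z w) • r) → ∀ w, z (p w) = p (z w)
  form_self_p : ∀ s, (∀ w, b s w • s = 0) → b s (p s) = 0

variable (B) in
include B in
theorem add_self_eq_zero_of_charTwo [CharP B 2] (x : M) : x + x = 0 := by
  rw [← two_smul B, CharTwo.two_eq_zero, zero_smul]

theorem transvection_mul_self [CharP B 2] {v : M} (hb : IsHexagonal b) (hv : ∀ w, b v w • v = 0) :
    transvection b v * transvection b v = 1 := by
  refine LinearMap.ext fun c => ?_
  rw [Module.End.mul_apply, transvection_apply, transvection_apply, Module.End.one_apply]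
  refine Prod.ext ?_ ?_
  · simp only [map_add, map_smul, hb.alt, smul_zero]
    grind
  · dsimp only
    rw [add_smul, hv, add_zero, add_assoc, add_self_eq_zero_of_charTwo B, add_zero]

namespace NormalForm

/-- The normal form of the identity. -/
def one [CharP B 2] (hb : IsHexagonal b) : NormalForm b 1 where
  α := 0
  θ := 0
  ω := 0
  ω' := 0
  p := LinearMap.id
  val_apply := by simp
  inv_apply := by simp
  adjoint := by simp
  hex z w u := by simp [add_self_eq_zero_of_charTwo B]
  form_ω_smul_ω := by simp
  form_ω'_smul_ω' := by simp
  form_ω'_smul_ω := by simp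
  θ_smul_ω := by simp
  θ_smul_ω' := by simp
  commute := by simp
  form_self_p s _ := hb.alt s

theorem form_smul_map {v : M} (hv : ∀ w, b v w • v = 0) (p : M →ₗ[B] M) (w : M) :
    b v w • p v = 0 := by
  rw [← map_smul, hv, map_zero]

variable {x : (Module.End B (B × M))ˣ} (f : NormalForm b x) (hb : IsHexagonal b)
include f

theorem θ_mul_form_ω (w : M) : f.θ * b f.ω w = 0 := by
  simpa using congrArg (fun c => b c w) f.θ_smul_ω

theorem θ_mul_form_ω' (w : M) : f.θ * b f.ω' w = 0 := by
  simpa using congrArg (fun c => b c w) f.θ_smul_ω'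

theorem θ_smul_θ_smul (w : M) : f.θ • f.θ • w = 0 := by
  rw [← f.form_ω'_smul_ω w, smul_comm, f.θ_smul_ω, smul_zero]

theorem p_p [CharP B 2] (w : M) : p f (f.p w) = w + f.α • w + f.θ • f.p w := by
  have := congrArg Prod.snd (val_inv_apply x (0, w))
  simp only [f.inv_apply, f.val_apply, map_add, map_smul, mul_zero, zero_smul, zero_add,
    f.form_ω_smul_ω] at this
  linear_combination (norm := (match_scalars <;> grind)) this

include hb

theorem α_smul_ω : f.α • f.ω = 0 := by
  rw [← f.form_ω_smul_ω, hb.alt, zero_smul]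

theorem α_smul_ω' : f.α • f.ω' = 0 := by
  rw [← f.form_ω'_smul_ω', hb.alt, zero_smul]

theorem α_mul_form_ω (w : M) : f.α * b f.ω w = 0 := by
  simpa using congrArg (fun c => b c w) (f.α_smul_ω hb)

theorem α_mul_form_ω' (w : M) : f.α * b f.ω' w = 0 := by
  simpa using congrArg (fun c => b c w) (f.α_smul_ω' hb)

theorem form_ω_smul_ω' (w : M) : b f.ω w • f.ω' = f.θ • w := by
  rw [← sub_eq_zero]
  refine hb.eq_zero _ fun t => ?_
  have := congrArg (fun c => b c w) (f.form_ω'_smul_ω t)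
  simp only [map_smul, LinearMap.smul_apply, smul_eq_mul] at this
  simp only [map_sub, map_smul, LinearMap.sub_apply, LinearMap.smul_apply, smul_eq_mul]
  linear_combination this + f.θ * hb.symm t w

theorem α_smul_θ_smul (w : M) : f.α • f.θ • w = 0 := by
  rw [← f.form_ω'_smul_ω, smul_comm, f.α_smul_ω hb, smul_zero]

variable [CharP B 2]

theorem form_ω'_p (w : M) : b f.ω' (f.p w) = b f.ω w := by
  have := congrArg Prod.fst (val_inv_apply x (0, w))
  simp only [f.inv_apply, f.val_apply, map_add, map_smul, mul_zero, zero_smul, zero_add,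
    smul_eq_mul] at this
  grind [f.α_mul_form_ω hb w, f.θ_mul_form_ω' w]

theorem α_mul_α : f.α * f.α = 0 := by
  have := congrArg Prod.fst (val_inv_apply x (1, 0))
  simp only [f.inv_apply, f.val_apply, map_zero, one_smul, smul_zero, add_zero, hb.alt] at this
  grind

theorem p_ω' : f.p f.ω' = f.ω := by
  have := congrArg Prod.snd (val_inv_apply x (1, 0))
  simp only [f.inv_apply, f.val_apply, map_zero, one_smul, smul_zero, add_zero, mul_one] at this
  linear_combination (norm := (match_scalars <;> grind)) this + f.α_smul_ω hb

theorem p_ω : f.p f.ω = f.ω' := by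
  have := congrArg Prod.snd (inv_val_apply x (1, 0))
  simp only [f.inv_apply, f.val_apply, map_zero, one_smul, add_zero, mul_one] at this
  linear_combination (norm := (match_scalars <;> grind)) this + f.α_smul_ω' hb + f.θ_smul_ω

theorem θ_smul_p (w : M) : f.θ • f.p w = f.α • w := by
  rw [← map_smul, ← f.form_ω_smul_ω' hb, map_smul, f.p_ω' hb, f.form_ω_smul_ω]


variable {v : M} (hv : ∀ w, b v w • v = 0)
include hv

theorem update_form_ω_smul_ω (w : M) :
    b (f.ω + f.p v) w • (f.ω + f.p v) = (f.α + b f.ω' v) • w := by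
  have h0 := f.hex v (f.p w + f.θ • w) v
  have h1 := congrArg f.p (hb.cyc f.ω' v (f.p w + f.θ • w))
  have h2 := f.α_mul_form_ω' hb v
  simp only [map_add, map_smul, LinearMap.add_apply, LinearMap.smul_apply, f.p_p, f.p_ω' hb,
    map_zero, hb.symm _ f.ω', f.form_ω'_p hb, smul_eq_mul, f.θ_mul_form_ω', hb.alt] at h0 h1
  have h3 := hv w
  have h4 := hv (f.p w)
  simp only [map_add, LinearMap.add_apply, f.adjoint]
  linear_combination (norm := (match_scalars <;> grind)) h1 + f.form_ω_smul_ω w + h0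
    + (1 + f.α) • h3

theorem update_form_ω'_smul_ω' (w : M) :
    b (f.ω' + (1 + f.α) • v) w • (f.ω' + (1 + f.α) • v) = (f.α + b f.ω' v) • w := by
  have h0 := hv w
  have h1 := hb.cyc f.ω' w v
  have h2 := f.α_smul_ω' hb
  have h3 := f.α_mul_form_ω' hb w
  simp only [map_add, map_smul, LinearMap.add_apply, LinearMap.smul_apply, smul_eq_mul]
  linear_combination (norm := (match_scalars <;> grind [hb.symm])) f.form_ω'_smul_ω' w +
    h1 + (1 + f.α) ^ 2 • h0 + b v w • h2

theorem update_form_ω'_smul_ω (w : M) :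
    b (f.ω' + (1 + f.α) • v) w • (f.ω + f.p v) = (f.θ + b f.ω v) • w := by
  have h0 := form_smul_map hv f.p w
  have h1 := congrArg f.p (hb.cyc f.ω' w v)
  have h2 := f.hex v f.ω' w
  have h3 := f.α_smul_ω hb
  simp only [map_add, map_smul, map_zero, f.p_ω' hb] at h1 h2
  have h4 := f.θ_smul_ω'
  simp only [map_add, map_smul, LinearMap.add_apply, LinearMap.smul_apply, smul_eq_mul]
  linear_combination (norm := (match_scalars <;> grind [hb.symm])) f.form_ω'_smul_ω w + h1 + h2
    + (1 + f.α) • h0 + b v w • h3 + b w v • h4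

theorem update_θ_smul_ω : (f.θ + b f.ω v) • (f.ω + f.p v) = 0 := by
  have h0 := form_smul_map hv f.p f.ω
  rw [hb.symm] at h0
  linear_combination (norm := (match_scalars <;> grind)) f.θ_smul_ω + f.form_ω_smul_ω v
    + f.θ_smul_p hb v + h0

theorem update_θ_smul_ω' : (f.θ + b f.ω v) • (f.ω' + (1 + f.α) • v) = 0 := by
  have h0 := hv f.ω
  rw [hb.symm] at h0
  linear_combination (norm := (match_scalars <;> grind)) f.θ_smul_ω' + f.form_ω_smul_ω' hb v
    + f.α_smul_θ_smul hb v + (1 + f.α) • h0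

/-- The normal form of the product with a transvection. -/
noncomputable def mulTransvection {y : (Module.End B (B × M))ˣ} (hy : y.val = transvection b v) :
    NormalForm b (x * y) where
  α := f.α + b f.ω' v
  θ := f.θ + b f.ω v
  ω := f.ω + f.p v
  ω' := f.ω' + (1 + f.α) • v
  p := f.p + (b v).smulRight f.ω
  val_apply a w := by
    rw [Units.val_mul, Module.End.mul_apply, hy, transvection_apply, f.val_apply]
    refine Prod.ext ?_ ?_
    · simp only [map_add, map_smul, LinearMap.add_apply, LinearMap.smul_apply, smul_eq_mul]
      ring
    · simp only [map_add, map_smul, LinearMap.add_apply, LinearMap.smulRight_apply]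
      module
  inv_apply a w := by
    have hy' : y.inv = transvection b v := by
      refine (left_inv_eq_right_inv ?_ y.val_inv).symm
      rw [hy, transvection_mul_self hb hv]
    change (y.inv * x.inv) (a, w) = _
    rw [Module.End.mul_apply, hy', f.inv_apply, transvection_apply]
    have := hb.cyc v w f.ω
    refine Prod.ext ?_ ?_
    · simp only [map_add, map_smul, LinearMap.add_apply, smul_eq_mul, f.adjoint]
      grind [hb.symm]
    · simp only [LinearMap.add_apply, LinearMap.smulRight_apply]
      linear_combination (norm := (match_scalars <;> grind [hb.symm])) this
  adjoint w u := by
    have := congrArg (fun c => b c u) (hb.cyc v w f.ω)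
    simp only [map_add, map_smul, LinearMap.add_apply, LinearMap.smul_apply, smul_eq_mul,
      LinearMap.smulRight_apply, f.adjoint, map_zero, LinearMap.zero_apply] at this ⊢
    grind [hb.symm]
  hex z w u := by
    simp only [map_add, map_smul, LinearMap.add_apply, smul_eq_mul, LinearMap.smulRight_apply]
    linear_combination (norm := (match_scalars <;> grind)) f.hex z w u + hb.hex f.ω v z w u
  form_ω_smul_ω := f.update_form_ω_smul_ω hb hv
  form_ω'_smul_ω' := f.update_form_ω'_smul_ω' hb hv
  form_ω'_smul_ω := f.update_form_ω'_smul_ω hb hv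
  θ_smul_ω := f.update_θ_smul_ω hb hv
  θ_smul_ω' := f.update_θ_smul_ω' hb hv
  commute z hz w := by
    simp only [LinearMap.add_apply, LinearMap.smulRight_apply, map_add, hz, f.commute z hz]
  form_self_p s hs := by
    have h0 := congrArg (b v) (hs f.ω)
    simp only [map_smul, map_zero, smul_eq_mul] at h0
    simp only [LinearMap.add_apply, LinearMap.smulRight_apply, map_add, map_smul, smul_eq_mul,
      f.form_self_p s hs]
    grind

omit hv

theorem pow_four_eq_one : x ^ 4 = 1 := by
  have hY (c : B × M) : x.val c + x.inv c =
      (b (f.ω + f.ω') c.2, c.1 • (f.ω + f.ω') + f.θ • c.2) := by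
    rw [← Prod.mk.eta (p := c), f.val_apply, f.inv_apply, Prod.mk_add_mk]
    refine Prod.ext ?_ ?_
    · simp only [map_add, LinearMap.add_apply]
      grind
    · dsimp only
      linear_combination (norm := (match_scalars <;> grind))
  have hYY (c : B × M) : x.val (x.val c + x.inv c) + x.inv (x.val c + x.inv c) = 0 := by
    have hθ (w : M) : f.θ * b (f.ω + f.ω') w = 0 := by
      simp [mul_add, f.θ_mul_form_ω, f.θ_mul_form_ω']
    rw [hY, hY]
    refine Prod.ext ?_ ?_
    · change b (f.ω + f.ω') (c.1 • (f.ω + f.ω') + f.θ • c.2) = 0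
      rw [map_add, map_smul, map_smul, hb.alt, smul_zero, zero_add, smul_eq_mul, hθ]
    · have h1 := f.form_ω_smul_ω c.2
      have h2 := f.form_ω'_smul_ω' c.2
      have h3 := f.form_ω_smul_ω' hb c.2
      have h4 := f.form_ω'_smul_ω c.2
      simp only [map_add, LinearMap.add_apply, Prod.snd_zero]
      linear_combination (norm := (match_scalars <;> grind)) h1 + h2 + h3 + h4
        + c.1 • f.θ_smul_ω + c.1 • f.θ_smul_ω' + f.θ_smul_θ_smul c.2
  have hsq : x ^ 2 = (x ^ 2)⁻¹ := by
    refine Units.ext (LinearMap.ext fun c => ?_)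
    have h := hYY c
    rw [map_add, map_add, val_inv_apply, inv_val_apply] at h
    rw [sq, mul_inv_rev]
    change x.val (x.val c) = x.inv (x.inv c)
    linear_combination (norm := module) h - add_self_eq_zero_of_charTwo B c -
      add_self_eq_zero_of_charTwo B (x.inv (x.inv c))
  rw [show 4 = 2 + 2 from rfl, pow_add]
  nth_rw 1 [hsq]
  rw [inv_mul_cancel]

theorem sub_one_mul_mul_sub_one {y : (Module.End B (B × M))ˣ} (g : NormalForm b y)
    (hx : x ^ 2 = 1) : (x.val - 1) * y.val * (x.val - 1) = 0 := by
  have hinv : x.inv = x.val := by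
    rw [sq] at hx
    exact congrArg Units.val (inv_eq_of_mul_eq_one_right hx)
  have hω : f.ω' = f.ω := by
    simpa only [f.val_apply, f.inv_apply, one_smul, map_zero, smul_zero, add_zero] using
      congrArg (fun e => (e (1, 0)).2) hinv
  have hθ (w : M) : f.θ • w = 0 := by
    simpa only [f.val_apply, f.inv_apply, zero_smul, zero_add, add_eq_left] using
      congrArg (fun e => (e (0, w)).2) hinv
  have hα (w : M) : f.α • w = 0 := by
    rw [← f.form_ω_smul_ω, ← hθ w, ← f.form_ω'_smul_ω, hω]
  have hωω (w : M) : b f.ω w • f.ω = 0 := by rw [f.form_ω_smul_ω, hα]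
  have hαb (v w : M) : f.α * b v w = 0 := by
    simpa using congrArg (fun c => b c w) (hα v)
  obtain ⟨z, hz⟩ : ∃ z, z = f.p + LinearMap.id := ⟨_, rfl⟩
  have hz_apply (w : M) : z w = f.p w + w := by rw [hz]; rfl
  have hzr (r s w : M) : b s w • z r = b s (z w) • r := by
    have h1 := f.hex s w r
    rw [mul_smul, hθ, add_zero] at h1
    rw [hz_apply, hz_apply, map_add]
    linear_combination (norm := (match_scalars <;> grind)) h1
  have hzω : z f.ω = 0 := by
    rw [hz_apply, f.p_ω hb, hω, add_self_eq_zero_of_charTwo B]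
  have hzz (w : M) : z (z w) = 0 := by
    have h1 := f.p_p w
    rw [hα, hθ] at h1
    rw [hz_apply, hz_apply, map_add, h1]
    linear_combination (norm := module) add_self_eq_zero_of_charTwo B (w + f.p w)
  have hzb (s w : M) : b s (z w) = b (z s) w := by
    have h1 := congrArg (fun c => b c w) (hθ s)
    simp only [map_smul, LinearMap.smul_apply, smul_eq_mul, map_zero, LinearMap.zero_apply] at h1
    simp only [hz_apply, map_add, LinearMap.add_apply, f.adjoint, h1, add_zero]
  have hzg (w : M) : g.p (z w) = z (g.p w) :=
    (g.commute z (fun r s w => by rw [map_smul, hzr]) w).symm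
  have hx_apply (a : B) (w : M) : (x.val - 1) (a, w) = (f.α * a + b f.ω w, a • f.ω + z w) := by
    rw [LinearMap.sub_apply, f.val_apply, hω, hz_apply]
    refine Prod.ext ?_ ?_
    · simp only [Module.End.one_apply, Prod.fst_sub]
      ring
    · simp only [Module.End.one_apply, Prod.snd_sub]
      linear_combination (norm := (match_scalars <;> grind))
  refine LinearMap.ext fun ⟨a, w⟩ => ?_
  rw [Module.End.mul_apply, Module.End.mul_apply, hx_apply, g.val_apply, hx_apply]
  refine Prod.ext ?_ ?_
  · have h1 : b f.ω w * b f.ω g.ω = 0 := by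
      simpa using congrArg (b · g.ω) (hωω w)
    have h2 := hαb f.ω g.ω
    have h3 := f.α_mul_α hb
    have h4 := hαb f.ω w
    have h5 := hαb g.ω' f.ω
    have h6 := hαb g.ω' (z w)
    have h7 := g.form_self_p f.ω hωω
    simp only [map_add, map_smul, smul_eq_mul, hzg, hzb f.ω, hzω, map_zero, LinearMap.zero_apply,
      h7]
    grind
  · have h1 := hωω w
    have h2 := hωω g.ω'
    have h3 := hzr f.ω g.ω' w
    have h4 := hzr g.ω f.ω w
    rw [hzb, hzω, map_zero, LinearMap.zero_apply, zero_smul] at h4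
    rw [hzω, smul_zero] at h3
    have hzpω : z (g.p f.ω) = 0 := by rw [← hzg, hzω, map_zero]
    have h5 := hα f.ω
    have h6 := hα (z g.ω)
    simp only [map_add, map_smul, smul_eq_mul, hzg, hzz, hzpω, smul_zero, add_zero,
      LinearMap.zero_apply, Prod.snd_zero]
    rw [hb.symm] at h2
    linear_combination (norm := (match_scalars <;> grind)) (1 + g.α) • h1 + a • h2 - h3 + h4 +
      (1 + g.α) • a • h5 + a • h6

end NormalForm

theorem commute_of_sub_one_mul {R : Type*} [Ring R] {x y : Rˣ}
    (h1 : (x.val - 1) * y.val * (x.val - 1) = 0)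
    (h2 : (x.val - 1) * y.inv * (x.val - 1) = 0) : Commute x (y⁻¹ * x * y) := by
  refine Units.ext ?_
  have e1 : y.inv * y.val = 1 := y.inv_val
  have e2 : (x.val - 1) * (y.inv * (x.val - 1) * y.val) =
      (y.inv * (x.val - 1) * y.val) * (x.val - 1) := by
    calc _ = ((x.val - 1) * y.inv * (x.val - 1)) * y.val := by noncomm_ring
      _ = y.inv * ((x.val - 1) * y.val * (x.val - 1)) := by rw [h1, h2, zero_mul, mul_zero]
      _ = _ := by noncomm_ring
  have e3 : y.inv * (x.val - 1) * y.val = y.inv * x.val * y.val - 1 := by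
    rw [mul_sub, sub_mul, mul_one, e1]
  rw [e3] at e2
  change x.val * (y.inv * x.val * y.val) = (y.inv * x.val * y.val) * x.val
  linear_combination (norm := noncomm_ring) e2

end NormalForm

theorem closure_involutions_closure {K : Type*} [Group K] {S : Set K} (hS : ∀ x ∈ S, x ^ 2 = 1) :
    Subgroup.closure {x : Subgroup.closure S | x ^ 2 = 1} = ⊤ := by
  rw [eq_top_iff, ← Subgroup.closure_closure_coe_preimage]
  exact Subgroup.closure_mono fun x hx => Subtype.ext (hS x hx)

section TransvectionGroup

variable {ι B M : Type*} [CommRing B] [AddCommGroup M] [Module B M] {b : M →ₗ[B] M →ₗ[B] B}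

/-- The group generated by the transvections in a family of vectors. -/
def transvectionGroup (b : M →ₗ[B] M →ₗ[B] B) (v : ι → M) :
    Subgroup (Module.End B (B × M))ˣ :=
  Subgroup.closure {x | ∃ i, x.val = transvection b (v i)}

/-- The endomorphism of `B × M` scaling `M` by `1 + γ`. -/
def scaling (M : Type*) [AddCommGroup M] [Module B M] (γ : B) : Module.End B (B × M) :=
  LinearMap.prodMap LinearMap.id (LinearMap.id + γ • LinearMap.id)

@[simp]
theorem scaling_apply (γ : B) (c : B × M) : scaling M γ c = (c.1, c.2 + γ • c.2) := rfl

variable [CharP B 2] (hb : IsHexagonal b)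
include hb

theorem transvection_mul_transvection {v w : M} (hv : ∀ u, b v u • v = 0)
    (hw : ∀ u, b w u • w = 0) :
    transvection b v * transvection b w =
      scaling M (b v w) * (transvection b w * transvection b v) := by
  refine LinearMap.ext fun c => ?_
  simp only [Module.End.mul_apply, transvection_apply, scaling_apply, map_add, map_smul,
    smul_eq_mul]
  refine Prod.ext ?_ ?_
  · dsimp only
    rw [hb.symm w v]
    ring
  · have h1 := hb.cyc v w c.2
    have h2 := hv w
    have h3 := hw v
    rw [hb.symm w v] at h3
    simp only [hb.symm _ v] at h1
    linear_combination (norm := (match_scalars <;> grind)) h1 + (c.1 + b v c.2) • h3 + c.1 • h2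

theorem scaling_mul_transvection {γ : B} (hγ : γ * γ = 0) {w : M} (hw : ∀ u, b w u • w = 0) :
    scaling M γ * transvection b w =
      transvection b (γ • w) * (transvection b w * scaling M γ) := by
  refine LinearMap.ext fun c => ?_
  simp only [Module.End.mul_apply, transvection_apply, scaling_apply, map_add, map_smul,
    smul_eq_mul, LinearMap.smul_apply, hb.alt]
  refine Prod.ext ?_ ?_
  · dsimp only
    grind
  · have h1 := hw c.2
    linear_combination (norm := (match_scalars <;> grind)) (γ + γ * γ) • h1

variable {v : ι → M} (hv : ∀ i u, b (v i) u • v i = 0)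
include hv

theorem nonempty_normalForm {x : (Module.End B (B × M))ˣ} (hx : x ∈ transvectionGroup b v) :
    Nonempty (NormalForm b x) := by
  induction hx using Subgroup.closure_induction_right with
  | one => exact ⟨NormalForm.one hb⟩
  | mul_right x _ y hy hf =>
    obtain ⟨i, hi⟩ := hy
    exact hf.map fun f => f.mulTransvection hb (hv i) hi
  | mul_inv_cancel x _ y hy hf =>
    obtain ⟨i, hi⟩ := hy
    have hyi : y⁻¹ = y := inv_eq_of_mul_eq_one_right
      (Units.ext (by rw [Units.val_mul, hi, transvection_mul_self hb (hv i), Units.val_one]))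
    rw [hyi]
    exact hf.map fun f => f.mulTransvection hb (hv i) hi

theorem transvectionGroup_pow_four (x : transvectionGroup b v) : x ^ 4 = 1 := by
  obtain ⟨f⟩ := nonempty_normalForm hb hv x.2
  exact Subtype.ext (f.pow_four_eq_one hb)

theorem transvectionGroup_lcomm_lcomm (x y : transvectionGroup b v) (hx : x ^ 2 = 1) :
    lcomm (lcomm y x) x = 1 := by
  obtain ⟨f⟩ := nonempty_normalForm hb hv x.2
  obtain ⟨g⟩ := nonempty_normalForm hb hv y.2
  obtain ⟨g'⟩ := nonempty_normalForm hb hv (y⁻¹).2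
  have hx' : x.val ^ 2 = 1 := congrArg Subtype.val hx
  have hc : Commute x.val (y.val⁻¹ * x.val * y.val) :=
    commute_of_sub_one_mul (f.sub_one_mul_mul_sub_one hb g hx')
      (f.sub_one_mul_mul_sub_one hb g' hx')
  have hc' : Commute (y⁻¹ * x * y) x := Subtype.ext hc.symm
  have : Commute (lcomm y x) x := by
    have h1 : lcomm y x = (y⁻¹ * x * y)⁻¹ * x := by rw [lcomm]; group
    rw [h1]
    exact hc'.inv_left.mul_left (Commute.refl x)
  rw [lcomm, mul_assoc _ (lcomm y x) x, this.eq]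
  group

theorem closure_involutions_transvectionGroup :
    Subgroup.closure {x : transvectionGroup b v | x ^ 2 = 1} = ⊤ := by
  refine closure_involutions_closure ?_
  rintro x ⟨i, hi⟩
  refine Units.ext ?_
  rw [Units.val_pow_eq_pow_val, hi, sq, transvection_mul_self hb (hv i), Units.val_one]

end TransvectionGroup

section DerivedSeries

open scoped commutatorElement

variable {R : Type*} [Monoid R] (H : Subgroup Rˣ)

/-- The values of the elements of a term of the derived series of a group of units. -/
def derivedValues (n : ℕ) : Set R :=
  {e | ∃ g ∈ (derivedSeries H n).map H.subtype, g.val = e}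

variable {H}

theorem derivedValues_zero {x : Rˣ} (hx : x ∈ H) : x.val ∈ derivedValues H 0 :=
  ⟨x, ⟨⟨x, hx⟩, Subgroup.mem_top _, rfl⟩, rfl⟩

theorem derivedValues_succ_subset (n : ℕ) : derivedValues H (n + 1) ⊆ derivedValues H n := by
  rintro _ ⟨g, hg, rfl⟩
  exact ⟨g, Subgroup.map_mono (derivedSeries_antitone _ n.le_succ) hg, rfl⟩

theorem mem_derivedValues_succ {n : ℕ} {x y z : R} (hx : x ∈ derivedValues H n)
    (hy : y ∈ derivedValues H n) (h : x * y = z * (y * x)) : z ∈ derivedValues H (n + 1) := by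
  obtain ⟨g, hg, rfl⟩ := hx
  obtain ⟨k, hk, rfl⟩ := hy
  refine ⟨⁅g, k⁆, ?_, ?_⟩
  · rw [derivedSeries_succ, Subgroup.map_commutator]
    exact Subgroup.commutator_mem_commutator hg hk
  · rw [commutatorElement_def, mul_assoc, ← mul_inv_rev, Units.val_mul, Units.val_mul, h,
      mul_assoc, ← Units.val_mul k g, Units.mul_inv, mul_one]

end DerivedSeries

section Levels

/-- The numbers of edges of the scalings and of the transvections that are found in the terms of
the derived series. -/
def level : ℕ → ℕ × ℕ
  | 0 => (1, 1)
  | n + 1 => (2 * (level n).2 + 1, (level n).1 + (level n).2)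

theorem level_fst_pos (n : ℕ) : 0 < (level n).1 := by
  cases n <;> simp [level]

variable {κ B M : Type*} [DecidableEq κ] [CommRing B] [CharP B 2] [AddCommGroup M] [Module B M]
  {b : M →ₗ[B] M →ₗ[B] B} (hb : IsHexagonal b) {v : κ × Bool → M}
  (hv : ∀ i u, b (v i) u • v i = 0)
include hb hv

omit [DecidableEq κ] [CharP B 2] hb in
theorem prod_form_mul_self {A : Finset κ} (hA : 0 < A.card) :
    (∏ j ∈ A, b (v (j, false)) (v (j, true))) * ∏ j ∈ A, b (v (j, false)) (v (j, true)) = 0 := by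
  rw [← Finset.prod_mul_distrib]
  obtain ⟨j, hj⟩ := Finset.card_pos.mp hA
  refine Finset.prod_eq_zero hj ?_
  simpa using congrArg (b · (v (j, true))) (hv (j, false) (v (j, true)))

theorem level_mem_derivedValues (n : ℕ) :
    (∀ A : Finset κ, A.card = (level n).1 →
      scaling M (∏ j ∈ A, b (v (j, false)) (v (j, true))) ∈
        derivedValues (transvectionGroup b v) n) ∧
    (∀ A : Finset κ, A.card = (level n).2 → ∀ i,
      transvection b ((∏ j ∈ A, b (v (j, false)) (v (j, true))) • v i) ∈
        derivedValues (transvectionGroup b v) n) := by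
  have hsmul (γ : B) (i : κ × Bool) (u : M) : b (γ • v i) u • γ • v i = 0 := by
    rw [map_smul, LinearMap.smul_apply, smul_comm, smul_assoc, hv, smul_zero, smul_zero]
  induction n with
  | zero =>
    have hT (i : κ × Bool) :
        transvection b (v i) ∈ derivedValues (transvectionGroup b v) 0 := by
      have h1 := transvection_mul_self hb (hv i)
      exact derivedValues_zero (x := ⟨_, _, h1, h1⟩) (Subgroup.subset_closure ⟨i, rfl⟩)
    have hH (j : κ) : scaling M (b (v (j, false)) (v (j, true))) ∈
        derivedValues (transvectionGroup b v) 0 :=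
      derivedValues_succ_subset 0 (mem_derivedValues_succ (hT _) (hT _)
        (transvection_mul_transvection hb (hv _) (hv _)))
    refine ⟨fun A hA => ?_, fun A hA i => ?_⟩
    · obtain ⟨j, rfl⟩ := Finset.card_eq_one.mp hA
      rw [Finset.prod_singleton]
      exact hH j
    · obtain ⟨j, rfl⟩ := Finset.card_eq_one.mp hA
      have hsq := prod_form_mul_self hv (A := {j}) (by simp)
      rw [Finset.prod_singleton] at hsq ⊢
      exact derivedValues_succ_subset 0 (mem_derivedValues_succ (hH j) (hT i)
        (scaling_mul_transvection hb hsq (hv i)))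
  | succ n ih =>
    obtain ⟨hH, hT⟩ := ih
    refine ⟨fun A hA => ?_, fun A hA i => ?_⟩
    · change A.card = 2 * (level n).2 + 1 at hA
      obtain ⟨j, hj⟩ := Finset.card_pos.mp (show 0 < A.card by omega)
      have hAj := Finset.card_erase_of_mem hj
      obtain ⟨A', hA', hcard⟩ := Finset.exists_subset_card_eq
        (show (level n).2 ≤ (A.erase j).card by omega)
      have hcard' := Finset.card_sdiff_of_subset hA'
      have h := mem_derivedValues_succ (hT A' hcard (j, false))
        (hT (A.erase j \ A') (by omega) (j, true))
        (transvection_mul_transvection hb (hsmul _ _) (hsmul _ _))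
      rw [← Finset.mul_prod_erase A _ hj, ← Finset.prod_sdiff hA']
      convert h using 2
      simp only [map_smul, LinearMap.smul_apply, smul_eq_mul]
      ring
    · change A.card = (level n).1 + (level n).2 at hA
      obtain ⟨A', hA', hcard⟩ := Finset.exists_subset_card_eq
        (show (level n).1 ≤ A.card by omega)
      have hcard' := Finset.card_sdiff_of_subset hA'
      rw [← Finset.prod_sdiff hA', mul_comm, mul_smul]
      exact mem_derivedValues_succ (hH A' hcard) (hT (A \ A') (by omega) i)
        (scaling_mul_transvection hb
          (prod_form_mul_self hv (hcard ▸ level_fst_pos n)) (hsmul _ _))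

theorem derivedSeries_transvectionGroup_ne_bot [Fintype κ] (n : ℕ)
    (hκ : Fintype.card κ = (level n).1 + 1)
    (hprod : ∏ j, b (v (j, false)) (v (j, true)) ≠ 0) :
    derivedSeries (transvectionGroup b v) n ≠ ⊥ := by
  intro hbot
  obtain ⟨j⟩ : Nonempty κ := Fintype.card_pos_iff.mp (hκ ▸ Nat.succ_pos _)
  obtain ⟨g, hg, hgv⟩ := (level_mem_derivedValues hb hv n).1 (Finset.univ.erase j) (by
    rw [Finset.card_erase_of_mem (Finset.mem_univ j), Finset.card_univ, hκ, Nat.add_sub_cancel])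
  rw [hbot, Subgroup.map_bot, Subgroup.mem_bot] at hg
  have h := congrArg (fun e => (e (0, v (j, false))).2) hgv
  simp only [hg, Units.val_one, Module.End.one_apply, scaling_apply, left_eq_add] at h
  refine hprod ?_
  rw [← Finset.mul_prod_erase _ _ (Finset.mem_univ j), mul_comm]
  simpa using congrArg (b · (v (j, true))) h

end Levels

theorem Letter.isEdgeSystem_edge (m : ℕ) : IsEdgeSystem (edge (m := m)) where
  comm := edge_comm
  self := edge_self
  mul := edge_mul_edge
  pluecker := edge_pluecker
  hexagon := hexagon_edge

/-- For every `n` there exists a finite group `G` of exponent 4 which is generated by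
its involutions, in which every involution is a left 2-Engel element, and whose derived
length is greater than `n` (i.e. the `n`-th term of the derived series is nontrivial). -/
theorem stmt_4 (n : ℕ) :
    ∃ (G : Type) (_ : Group G), Finite G ∧
      (∀ g : G, g ^ 4 = 1) ∧
      Subgroup.closure {g : G | g ^ 2 = 1} = ⊤ ∧
      (∀ u : G, u ^ 2 = 1 → ∀ x : G, lcomm (lcomm x u) u = 1) ∧
      derivedSeries G n ≠ ⊥ := by
  have h := Letter.isEdgeSystem_edge (level n).1
  have hb := h.isHexagonal_form
  have hv := h.form_vec_smul_vec
  refine ⟨transvectionGroup h.form (IsEdgeSystem.vec _), inferInstance, ?_,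
    transvectionGroup_pow_four hb hv, closure_involutions_transvectionGroup hb hv,
    fun u hu x => transvectionGroup_lcomm_lcomm hb hv u x hu,
    derivedSeries_transvectionGroup_ne_bot hb hv n (Fintype.card_fin _) ?_⟩
  · have : Finite (IsEdgeSystem.Space (Letter.edge (m := (level n).1))) :=
      Finite.of_surjective _ (Submodule.mkQ_surjective _)
    have := DFunLike.finite (Module.End (Letter.Coeff (level n).1) (Letter.Coeff (level n).1 ×
      IsEdgeSystem.Space (Letter.edge (m := (level n).1))))
    infer_instance
  · simpa only [h.form_vec] using Letter.prod_edge_ne_zero
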